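/- Let D ⊂ ℝ^d be a bounded region defined by a finite collection of polynomial inequalities F_i(x_1,…,x_d) ≥ 0, 1 ≤ i ≤ k, where each F_i has real coefficients and degree at most m. Then |#(D ∩ ℤ^d) − mes_d D| ≤ C·max(V̄, 1), where C depends only on d, k, m, and V̄ is the maximum over 1 ≤ r ≤ d−1 and over all r-element subsets J of the coordinates of the r-dimensional Lebesgue measure of the orthogonal projection of D onto the coordinate subspace indexed by J. -/

import Mathlib

open MeasureTheory

lemma dv_extend (A : Finset ℝ) : ∀ (f : ℝ → ℝ), StrictMonoOn f (A : Set ℝ) →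
    ∃ φ : ℝ ≃o ℝ, ∀ a ∈ A, φ a = f a := by
  induction A using Finset.induction_on_max with
  | empty => intro f _; exact ⟨OrderIso.refl ℝ, by simp⟩
  | insert a s hs ih =>
    intro f hf
    obtain ⟨φ, hφ⟩ := ih f (hf.mono (by intro x hx; simp at hx ⊢; exact Or.inr hx))
    rcases s.eq_empty_or_nonempty with rfl | hne
    · refine ⟨OrderIso.addRight (f a - a), ?_⟩
      intro b hb
      simp at hb
      subst hb
      simp
    · set b := s.max' hne with hb
      have hbs : b ∈ s := s.max'_mem hne
      have hba : b < a := hs b hbs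
      set c := f b with hc
      have hcv : c < f a := hf (by simp [hbs]) (by simp) hba
      have hcb : φ b = c := hφ b hbs
      have hca : c < φ a := by rw [← hcb]; exact φ.strictMono hba
      set k := (f a - c) / (φ a - c) with hk
      have hkpos : 0 < k := div_pos (by linarith) (by linarith)
      let ψ : ℝ → ℝ := fun t => if t ≤ c then t else c + (t - c) * k
      have hψ : StrictMono ψ := by
        intro u v huv
        simp only [ψ]
        split_ifs with h1 h2 h2
        · exact huv
        · have := mul_pos (sub_pos.2 (not_le.1 h2)) hkpos
          linarith
        · linarith
        · have := mul_lt_mul_of_pos_right (sub_lt_sub_right huv c) hkpos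
          linarith
      have hsurj : Function.Surjective ψ := by
        intro v
        by_cases h : v ≤ c
        · exact ⟨v, by simp [ψ, h]⟩
        · refine ⟨c + (v - c) / k, ?_⟩
          have h1 : 0 < (v - c) / k := div_pos (by linarith) hkpos
          have : ¬ (c + (v - c) / k ≤ c) := by linarith
          simp only [ψ, this, if_false]
          field_simp
          ring
      refine ⟨φ.trans (StrictMono.orderIsoOfSurjective ψ hψ hsurj), ?_⟩
      intro x hx
      simp only [OrderIso.trans_apply, StrictMono.coe_orderIsoOfSurjective]
      rcases Finset.mem_insert.1 hx with rfl | hx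
      · have : ¬ (φ x ≤ c) := not_le.2 hca
        simp only [ψ, this, if_false, hk]
        have : φ x - c ≠ 0 := by linarith
        field_simp
        ring
      · have : φ x ≤ c := by
          rw [← hcb]; exact φ.monotone (s.le_max' x hx)
        simp only [ψ, this, if_true]
        exact hφ x hx

def DvSG (Z : Finset ℝ) (t u : ℝ) : Prop := ∀ z ∈ Z, (z < t ↔ z < u) ∧ (t < z ↔ u < z)

lemma DvSG.symm {Z : Finset ℝ} {t u : ℝ} (h : DvSG Z t u) : DvSG Z u t :=
  fun z hz => ⟨(h z hz).1.symm, (h z hz).2.symm⟩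

lemma DvSG.trans {Z : Finset ℝ} {t u v : ℝ} (h : DvSG Z t u) (h' : DvSG Z u v) : DvSG Z t v :=
  fun z hz => ⟨(h z hz).1.trans (h' z hz).1, (h z hz).2.trans (h' z hz).2⟩

lemma DvSG.notMem {Z : Finset ℝ} {t u : ℝ} (h : DvSG Z t u) (ht : t ∉ Z) : u ∉ Z := by
  intro hu
  have := h u hu
  have h1 : ¬ u < t := by rw [this.1]; exact lt_irrefl _
  have h2 : ¬ t < u := by rw [this.2]; exact lt_irrefl _
  have : t = u := le_antisymm (not_lt.1 h1) (not_lt.1 h2)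
  exact ht (this ▸ hu)

lemma DvSG.between {Z : Finset ℝ} {t u c : ℝ} (h : DvSG Z t u) (ht : t ∉ Z)
    (hc : c ∈ Set.uIcc t u) : DvSG Z t c := by
  have hu := h.notMem ht
  intro z hz
  have hzt : z ≠ t := fun e => ht (e ▸ hz)
  have hzu : z ≠ u := fun e => hu (e ▸ hz)
  have := h z hz
  rw [Set.mem_uIcc] at hc
  grind

lemma dv_ivt {g : ℝ → ℝ} (hg : Continuous g) {a b : ℝ}
    (h : SignType.sign (g a) ≠ SignType.sign (g b)) : ∃ c ∈ Set.uIcc a b, g c = 0 := by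
  have key : (0:ℝ) ∈ Set.uIcc (g a) (g b) := by
    rw [Set.mem_uIcc]
    by_contra hcon
    push Not at hcon
    apply h
    rcases lt_trichotomy (g a) 0 with h1 | h1 | h1 <;> rcases lt_trichotomy (g b) 0 with h2 | h2 | h2 <;>
      first
      | (simp [h1, h2]; done)
      | (exfalso; have h3 := hcon.1; have h4 := hcon.2; grind)
  obtain ⟨c, hc, h0⟩ := intermediate_value_uIcc (hg.continuousOn) key
  exact ⟨c, hc, h0⟩

section core
variable {Z : Finset ℝ} {f g : ℝ → ℝ}

lemma dv_gap (Z : Finset ℝ) (t : ℝ) (ht : t ∉ Z) : ∃ a b, a < t ∧ t < b ∧ DvSG Z t a ∧ DvSG Z t b := by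
  have h : (Z : Set ℝ)ᶜ ∈ nhds t := (Z.finite_toSet.isClosed.isOpen_compl).mem_nhds (by simpa using ht)
  obtain ⟨e, he, hb⟩ := Metric.mem_nhds_iff.1 h
  have key : ∀ z ∈ Z, z ≤ t - e ∨ t + e ≤ z := by
    intro z hz
    by_contra hcon
    push Not at hcon
    have : z ∈ Metric.ball t e := by
      rw [Metric.mem_ball, Real.dist_eq, abs_lt]; constructor <;> linarith
    exact hb this (by simpa using hz)
  refine ⟨t - e/2, t + e/2, by linarith, by linarith, ?_, ?_⟩ <;>
  · intro z hz
    rcases key z hz with h | h <;> constructor <;> constructor <;> intro <;> linarith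

lemma dv_right (hg : Continuous g) (hs : ∀ z ∈ Z, SignType.sign (f z) = SignType.sign (g z))
    {M : ℝ} (hM : ∀ t, M ≤ t → SignType.sign (f t) = SignType.sign (g t))
    {t : ℝ} (ht : t ∉ Z) (h0 : f t ≠ 0)
    (hR : ∀ b, t < b → (∀ c ∈ Set.Ioo t b, c ∉ Z) → SignType.sign (f b) = SignType.sign (f t)) :
    ∃ t', DvSG Z t t' ∧ SignType.sign (g t') = SignType.sign (f t) := by
  by_cases hne : (Z.filter (fun z => t < z)).Nonempty
  · set b := (Z.filter (fun z => t < z)).min' hne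
    have hb : b ∈ Z.filter (fun z => t < z) := Finset.min'_mem _ hne
    rw [Finset.mem_filter] at hb
    have hmin : ∀ z ∈ Z, t < z → b ≤ z := fun z hz htz =>
      Finset.min'_le _ _ (Finset.mem_filter.2 ⟨hz, htz⟩)
    have hfb := hR b hb.2 (by
      intro c hc hcZ
      have := hmin c hcZ hc.1
      exact absurd hc.2 (not_lt.2 this))
    have hgb : SignType.sign (g b) = SignType.sign (f t) := by rw [← hs b hb.1, hfb]
    have hev : ∀ᶠ u in nhds b, SignType.sign (g u) = SignType.sign (g b) := by
      rcases lt_or_gt_of_ne h0 with h1 | h1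
      · have h2 : g b < 0 := by
          rw [sign_neg h1] at hgb; exact sign_eq_neg_one_iff.1 hgb
        filter_upwards [hg.continuousAt.eventually_lt continuousAt_const h2] with u hu
        rw [sign_neg hu, sign_neg h2]
      · have h2 : 0 < g b := by
          rw [sign_pos h1] at hgb; exact sign_eq_one_iff.1 hgb
        filter_upwards [continuousAt_const.eventually_lt hg.continuousAt h2] with u hu
        rw [sign_pos hu, sign_pos h2]
    have hev2 : ∀ᶠ u in nhdsWithin b (Set.Iio b), t < u ∧ u < b ∧ SignType.sign (g u) = SignType.sign (g b) := by
      filter_upwards [nhdsWithin_le_nhds hev, self_mem_nhdsWithin, nhdsWithin_le_nhds (lt_mem_nhds hb.2)] with u h1 h2 h3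
      exact ⟨h3, h2, h1⟩
    obtain ⟨u, h1, h2, h3⟩ := hev2.exists
    refine ⟨u, ?_, by rw [h3, hgb]⟩
    intro z hz
    have hzt : z ≠ t := fun e => ht (e ▸ hz)
    rcases lt_or_gt_of_ne hzt with h4 | h4
    · constructor <;> constructor <;> intro <;> linarith
    · have := hmin z hz h4
      constructor <;> constructor <;> intro <;> linarith
  · have hno : ∀ z ∈ Z, z < t := by
      intro z hz
      by_contra hcon
      have hzt : z ≠ t := fun e => ht (e ▸ hz)
      exact hne ⟨z, Finset.mem_filter.2 ⟨hz, lt_of_le_of_ne (not_lt.1 hcon) hzt.symm⟩⟩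
    refine ⟨max (t+1) M, ?_, ?_⟩
    · have h1 : t + 1 ≤ max (t+1) M := le_max_left _ _
      intro z hz
      have := hno z hz
      constructor <;> constructor <;> intro <;> linarith
    · rw [← hM _ (le_max_right _ _)]
      apply hR
      · exact lt_of_lt_of_le (by linarith) (le_max_left (t+1) M)
      · intro c hc hcZ
        exact absurd (hno c hcZ) (not_lt.2 hc.1.le)

lemma dv_left (hg : Continuous g) (hs : ∀ z ∈ Z, SignType.sign (f z) = SignType.sign (g z))
    {M : ℝ} (hM : ∀ t, t ≤ M → SignType.sign (f t) = SignType.sign (g t))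
    {t : ℝ} (ht : t ∉ Z) (h0 : f t ≠ 0)
    (hR : ∀ b, b < t → (∀ c ∈ Set.Ioo b t, c ∉ Z) → SignType.sign (f b) = SignType.sign (f t)) :
    ∃ t', DvSG Z t t' ∧ SignType.sign (g t') = SignType.sign (f t) := by
  classical
  have := dv_right (Z := Z.image (fun z => -z)) (f := fun t => f (-t)) (g := fun t => g (-t)) (M := -M) (t := -t)
    (hg.comp continuous_neg) (by simpa using hs) (fun u hu => hM _ (by linarith)) (by simpa using ht) (by simpa using h0)
    (by
      intro b hb hc
      rw [neg_neg]
      apply hR (-b) (by linarith)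
      intro c hcc hcZ
      exact hc (-c) ⟨by linarith [hcc.2], by linarith [hcc.1]⟩ (Finset.mem_image.2 ⟨c, hcZ, rfl⟩))
  obtain ⟨t', h1, h2⟩ := this
  refine ⟨-t', ?_, by simpa using h2⟩
  intro z hz
  have := h1 (-z) (Finset.mem_image.2 ⟨z, hz, rfl⟩)
  constructor
  · constructor
    · intro h; have := this.2.1 (by linarith); linarith
    · intro h; have := this.2.2 (by linarith); linarith
  · constructor
    · intro h; have := this.1.1 (by linarith); linarith
    · intro h; have := this.1.2 (by linarith); linarith

lemma dv_claimA_ne (hg : Continuous g) (hs : ∀ z ∈ Z, SignType.sign (f z) = SignType.sign (g z))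
    {M : ℝ} (hM : ∀ t, M ≤ t → SignType.sign (f t) = SignType.sign (g t))
    {M' : ℝ} (hM' : ∀ t, t ≤ M' → SignType.sign (f t) = SignType.sign (g t))
    (hmono : ∀ a b, a < b → (∀ c ∈ Set.Ioo a b, c ∉ Z) →
      StrictMonoOn f (Set.Icc a b) ∨ StrictAntiOn f (Set.Icc a b))
    {t : ℝ} (ht : t ∉ Z) (h0 : f t ≠ 0) :
    ∃ t', DvSG Z t t' ∧ SignType.sign (g t') = SignType.sign (f t) := by
  by_contra hcon
  have h1 : ¬ ∀ b, t < b → (∀ c ∈ Set.Ioo t b, c ∉ Z) → SignType.sign (f b) = SignType.sign (f t) :=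
    fun h => hcon (dv_right hg hs hM ht h0 h)
  have h2 : ¬ ∀ b, b < t → (∀ c ∈ Set.Ioo b t, c ∉ Z) → SignType.sign (f b) = SignType.sign (f t) :=
    fun h => hcon (dv_left hg hs hM' ht h0 h)
  push Not at h1 h2
  obtain ⟨b, hb, hbZ, hbs⟩ := h1
  obtain ⟨a, ha, haZ, has⟩ := h2
  have hm := hmono a b (ha.trans hb) (by
    intro c hc hcZ
    rcases lt_trichotomy c t with h | h | h
    · exact haZ c ⟨hc.1, h⟩ hcZ
    · exact ht (h ▸ hcZ)
    · exact hbZ c ⟨h, hc.2⟩ hcZ)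
  have ma : a ∈ Set.Icc a b := ⟨le_rfl, by linarith⟩
  have mt : t ∈ Set.Icc a b := ⟨ha.le, hb.le⟩
  have mb : b ∈ Set.Icc a b := ⟨by linarith, le_rfl⟩
  rcases hm with hm | hm
  · have e1 := hm ma mt ha
    have e2 := hm mt mb hb
    rcases lt_or_gt_of_ne h0 with h | h
    · exact has (by rw [sign_neg h, sign_neg (by linarith)])
    · exact hbs (by rw [sign_pos h, sign_pos (by linarith)])
  · have e1 := hm ma mt ha
    have e2 := hm mt mb hb
    rcases lt_or_gt_of_ne h0 with h | h
    · exact hbs (by rw [sign_neg h, sign_neg (by linarith)])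
    · exact has (by rw [sign_pos h, sign_pos (by linarith)])

lemma dv_claimA (hg : Continuous g) (hs : ∀ z ∈ Z, SignType.sign (f z) = SignType.sign (g z))
    {M : ℝ} (hM : ∀ t, M ≤ t → SignType.sign (f t) = SignType.sign (g t))
    {M' : ℝ} (hM' : ∀ t, t ≤ M' → SignType.sign (f t) = SignType.sign (g t))
    (hmono : ∀ a b, a < b → (∀ c ∈ Set.Ioo a b, c ∉ Z) →
      StrictMonoOn f (Set.Icc a b) ∨ StrictAntiOn f (Set.Icc a b))
    {t : ℝ} (ht : t ∉ Z) :
    ∃ t', DvSG Z t t' ∧ SignType.sign (g t') = SignType.sign (f t) := by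
  by_cases h0 : f t = 0
  · obtain ⟨a, b, ha, hb, hSa, hSb⟩ := dv_gap Z t ht
    have hm := hmono a b (ha.trans hb) (by
      intro c hc hcZ
      have h1 := hSa c hcZ
      have h2 := hSb c hcZ
      have h3 := hc.1
      have h4 := hc.2
      grind)
    have ma : a ∈ Set.Icc a b := ⟨le_rfl, by linarith⟩
    have mt : t ∈ Set.Icc a b := ⟨ha.le, hb.le⟩
    have mb : b ∈ Set.Icc a b := ⟨by linarith, le_rfl⟩
    have hab : f a ≠ 0 ∧ f b ≠ 0 ∧ SignType.sign (f a) ≠ SignType.sign (f b) := by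
      rcases hm with hm | hm
      · have e1 := hm ma mt ha
        have e2 := hm mt mb hb
        rw [h0] at e1 e2
        exact ⟨e1.ne, e2.ne', by rw [sign_neg e1, sign_pos e2]; decide⟩
      · have e1 := hm ma mt ha
        have e2 := hm mt mb hb
        rw [h0] at e1 e2
        exact ⟨e1.ne', e2.ne, by rw [sign_pos e1, sign_neg e2]; decide⟩
    obtain ⟨a', hSa', ha'⟩ := dv_claimA_ne hg hs hM hM' hmono (hSa.notMem ht) hab.1
    obtain ⟨b', hSb', hb'⟩ := dv_claimA_ne hg hs hM hM' hmono (hSb.notMem ht) hab.2.1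
    obtain ⟨c, hc, hc0⟩ := dv_ivt hg (a := a') (b := b') (by rw [ha', hb']; exact hab.2.2)
    have hta' := hSa.trans hSa'
    have htb' := hSb.trans hSb'
    refine ⟨c, hta'.trans ((hta'.symm.trans htb').between (hta'.notMem ht) hc), by rw [hc0, h0]⟩
  · exact dv_claimA_ne hg hs hM hM' hmono ht h0

lemma dv_core (hf : Continuous f) (hg : Continuous g)
    (hs : ∀ z ∈ Z, SignType.sign (f z) = SignType.sign (g z))
    {M : ℝ} (hM : ∀ t, M ≤ t → SignType.sign (f t) = SignType.sign (g t))
    {M' : ℝ} (hM' : ∀ t, t ≤ M' → SignType.sign (f t) = SignType.sign (g t))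
    (hmono : ∀ a b, a < b → (∀ c ∈ Set.Ioo a b, c ∉ Z) →
      (StrictMonoOn f (Set.Icc a b) ∧ StrictMonoOn g (Set.Icc a b)) ∨
      (StrictAntiOn f (Set.Icc a b) ∧ StrictAntiOn g (Set.Icc a b)))
    (Rf : Finset ℝ) (hRf : ∀ t, f t = 0 → t ∈ Rf) :
    ∃ ψ : ℝ ≃o ℝ, (∀ t, t ∉ Z → DvSG Z t (ψ t)) ∧ (∀ z ∈ Z, ψ z = z) ∧
      ∀ t, SignType.sign (f t) = SignType.sign (g (ψ t)) := by
  classical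
  have hA : ∀ t, t ∉ Z → ∃ t', DvSG Z t t' ∧ SignType.sign (g t') = SignType.sign (f t) := fun t ht =>
    dv_claimA hg hs hM hM' (fun a b hab hc => (hmono a b hab hc).imp And.left And.left) ht
  have hA' : ∀ t, t ∉ Z → ∃ t', DvSG Z t t' ∧ SignType.sign (f t') = SignType.sign (g t) := fun t ht =>
    dv_claimA hf (fun z hz => (hs z hz).symm) (fun t h => (hM t h).symm) (fun t h => (hM' t h).symm)
      (fun a b hab hc => (hmono a b hab hc).imp And.right And.right) ht
  have hF : ∀ a, ∃ a', (a ∈ Z → a' = a) ∧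
      (a ∉ Z → DvSG Z a a' ∧ SignType.sign (g a') = SignType.sign (f a)) := by
    intro a
    by_cases ha : a ∈ Z
    · exact ⟨a, fun _ => rfl, fun h => absurd ha h⟩
    · obtain ⟨a', h⟩ := hA a ha
      exact ⟨a', fun h => absurd h ha, fun _ => h⟩
  choose F hF1 hF2 using hF
  obtain ⟨ψ, hψ⟩ := dv_extend (Z ∪ Rf.filter (fun t => f t = 0)) F (by
    intro a ha b hb hab
    have ha : a ∈ Z ∨ f a = 0 := by simp at ha; tauto
    have hb : b ∈ Z ∨ f b = 0 := by simp at hb; tauto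
    by_cases haZ : a ∈ Z
    · rw [hF1 a haZ]
      by_cases hbZ : b ∈ Z
      · rw [hF1 b hbZ]; exact hab
      · exact ((hF2 b hbZ).1 a haZ).1.1 hab
    · by_cases hbZ : b ∈ Z
      · rw [hF1 b hbZ]; exact ((hF2 a haZ).1 b hbZ).2.1 hab
      · have fa := ha.resolve_left haZ
        have fb := hb.resolve_left hbZ
        have : ∃ z ∈ Z, a < z ∧ z < b := by
          by_contra hcon
          push Not at hcon
          rcases hmono a b hab (fun c hc hcZ => absurd hc.2 (not_lt.2 (hcon c hcZ hc.1))) with h | h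
          · have := h.1 ⟨le_rfl, hab.le⟩ ⟨hab.le, le_rfl⟩ hab
            linarith
          · have := h.1 ⟨le_rfl, hab.le⟩ ⟨hab.le, le_rfl⟩ hab
            linarith
        obtain ⟨z, hz, h1, h2⟩ := this
        exact (((hF2 a haZ).1 z hz).2.1 h1).trans (((hF2 b hbZ).1 z hz).1.1 h2))
  have hψZ : ∀ z ∈ Z, ψ z = z := fun z hz => by
    rw [hψ z (Finset.mem_union_left _ hz), hF1 z hz]
  have hψS : ∀ t, DvSG Z t (ψ t) := by
    intro t z hz
    have h1 : z < t ↔ ψ z < ψ t := ψ.lt_iff_lt.symm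
    have h2 : t < z ↔ ψ t < ψ z := ψ.lt_iff_lt.symm
    rw [hψZ z hz] at h1 h2
    exact ⟨h1, h2⟩
  have hψ0 : ∀ t, t ∉ Z → f t = 0 → g (ψ t) = 0 := by
    intro t ht h0
    rw [hψ t (Finset.mem_union_right _ (Finset.mem_filter.2 ⟨hRf t h0, h0⟩))]
    have := (hF2 t ht).2
    rw [h0, sign_zero, sign_eq_zero_iff] at this
    exact this
  refine ⟨ψ, fun t _ => hψS t, hψZ, ?_⟩
  intro t
  by_cases ht : t ∈ Z
  · rw [hψZ t ht]; exact hs t ht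
  by_cases h0 : f t = 0
  · rw [hψ0 t ht h0, h0]
  by_cases hroot : ∃ r, f r = 0 ∧ DvSG Z t r
  · obtain ⟨r, hr0, hr⟩ := hroot
    have hrZ := hr.notMem ht
    have hg0 := hψ0 r hrZ hr0
    have s1 := hψS t
    have s2 := hr.trans (hψS r)
    set m := min (min t r) (min (ψ t) (ψ r)) with hm
    set m' := max (max t r) (max (ψ t) (ψ r)) with hm'
    have i1 : t ∈ Set.Icc m m' := by simp [hm, hm']
    have i2 : r ∈ Set.Icc m m' := by simp [hm, hm']
    have i3 : ψ t ∈ Set.Icc m m' := by simp [hm, hm']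
    have i4 : ψ r ∈ Set.Icc m m' := by simp [hm, hm']
    have hne : t ≠ r := fun e => h0 (e ▸ hr0)
    have hmm : m < m' := by
      rcases lt_or_gt_of_ne hne with h | h
      · exact lt_of_le_of_lt i1.1 (lt_of_lt_of_le h i2.2)
      · exact lt_of_le_of_lt i2.1 (lt_of_lt_of_le h i1.2)
    have hmn := hmono m m' hmm (by
      intro c hc hcZ
      have h1 := hr c hcZ
      have h2 := s1 c hcZ
      have h3 := s2 c hcZ
      have hct : c ≠ t := fun e => ht (e ▸ hcZ)
      have h4 := hc.1
      have h5 := hc.2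
      simp only [hm, hm', min_lt_iff, lt_max_iff] at h4 h5
      grind)
    rcases lt_or_gt_of_ne hne with h | h
    · have hψh := ψ.strictMono h
      rcases hmn with hh | hh
      · have e1 := hh.1 i1 i2 h
        have e2 := hh.2 i3 i4 hψh
        rw [hr0] at e1; rw [hg0] at e2
        rw [sign_neg e1, sign_neg e2]
      · have e1 := hh.1 i1 i2 h
        have e2 := hh.2 i3 i4 hψh
        rw [hr0] at e1; rw [hg0] at e2
        rw [sign_pos e1, sign_pos e2]
    · have hψh := ψ.strictMono h
      rcases hmn with hh | hh
      · have e1 := hh.1 i2 i1 h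
        have e2 := hh.2 i4 i3 hψh
        rw [hr0] at e1; rw [hg0] at e2
        rw [sign_pos e1, sign_pos e2]
      · have e1 := hh.1 i2 i1 h
        have e2 := hh.2 i4 i3 hψh
        rw [hr0] at e1; rw [hg0] at e2
        rw [sign_neg e1, sign_neg e2]
  · obtain ⟨t', h1, h2⟩ := hA' (ψ t) ((hψS t).notMem ht)
    rw [← h2]
    by_contra hne
    obtain ⟨c, hc, hc0⟩ := dv_ivt hf hne
    exact hroot ⟨c, hc0, ((hψS t).trans h1).between ht hc⟩

end core

open Polynomial in
lemma dv_atTop (p : ℝ[X]) (hp : 0 < p.natDegree) :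
    ∃ M, ∀ t, M ≤ t → SignType.sign (p.eval t) = SignType.sign p.leadingCoeff := by
  have hdeg : 0 < p.degree := natDegree_pos_iff_degree_pos.1 hp
  have hne : p.leadingCoeff ≠ 0 := by
    intro h
    rw [leadingCoeff_eq_zero] at h
    simp [h] at hp
  rcases lt_or_gt_of_ne hne with h | h
  · have := (p.tendsto_atBot_of_leadingCoeff_nonpos hdeg h.le).eventually (Filter.eventually_lt_atBot 0)
    obtain ⟨M, hM⟩ := Filter.eventually_atTop.1 this
    exact ⟨M, fun t ht => by rw [sign_neg h, sign_neg (hM t ht)]⟩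
  · have := (p.tendsto_atTop_of_leadingCoeff_nonneg hdeg h.le).eventually (Filter.eventually_gt_atTop 0)
    obtain ⟨M, hM⟩ := Filter.eventually_atTop.1 this
    exact ⟨M, fun t ht => by rw [sign_pos h, sign_pos (hM t ht)]⟩

open Polynomial in
lemma dv_atBot (p : ℝ[X]) (hp : 0 < p.natDegree) :
    ∃ M, ∀ t, t ≤ M → SignType.sign (p.eval t) =
      SignType.sign p.leadingCoeff * SignType.sign ((-1 : ℝ) ^ p.natDegree) := by
  have h1 : (p.comp (-X)).natDegree = p.natDegree := by
    rw [natDegree_comp]; simp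
  obtain ⟨M, hM⟩ := dv_atTop (p.comp (-X)) (by rw [h1]; exact hp)
  refine ⟨-M, fun t ht => ?_⟩
  have := hM (-t) (by linarith)
  rw [leadingCoeff_comp (by simp)] at this
  simp only [eval_comp, eval_neg, eval_X, neg_neg, leadingCoeff_neg, leadingCoeff_X] at this
  rw [this, sign_mul]

open Polynomial in
lemma dv_poly (p q : ℝ[X]) (φ : ℝ ≃o ℝ) (Z : Finset ℝ) (hp : 0 < p.natDegree)
    (hdeg : p.natDegree = q.natDegree)
    (hlc : SignType.sign p.leadingCoeff = SignType.sign q.leadingCoeff)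
    (hZ : ∀ t, p.derivative.eval t = 0 → t ∈ Z)
    (hd : ∀ t, SignType.sign (p.derivative.eval t) = SignType.sign (q.derivative.eval (φ t)))
    (hs : ∀ z ∈ Z, SignType.sign (p.eval z) = SignType.sign (q.eval (φ z))) :
    ∃ ψ : ℝ ≃o ℝ, (∀ t, t ∉ Z → DvSG Z t (ψ t)) ∧ (∀ z ∈ Z, ψ z = z) ∧
      ∀ t, SignType.sign (p.eval t) = SignType.sign (q.eval (φ (ψ t))) := by
  obtain ⟨M1, hM1⟩ := dv_atTop p hp
  obtain ⟨M2, hM2⟩ := dv_atTop q (hdeg ▸ hp)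
  obtain ⟨N1, hN1⟩ := dv_atBot p hp
  obtain ⟨N2, hN2⟩ := dv_atBot q (hdeg ▸ hp)
  refine dv_core (f := fun t => p.eval t) (g := fun t => q.eval (φ t)) (M := max M1 (φ.symm M2))
    (M' := min N1 (φ.symm N2)) p.continuous (q.continuous.comp φ.continuous) hs ?_ ?_ ?_
    p.roots.toFinset ?_
  · intro t ht
    rw [hM1 t ((le_max_left _ _).trans ht), hM2 (φ t), hlc]
    have := (le_max_right M1 (φ.symm M2)).trans ht
    rwa [← OrderIso.symm_apply_le]
  · intro t ht
    rw [hN1 t (ht.trans (min_le_left _ _)), hN2 (φ t), hlc, hdeg]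
    have := ht.trans (min_le_right N1 (φ.symm N2))
    rwa [← OrderIso.le_symm_apply]
  · intro a b hab hc
    have hab' := φ.strictMono hab
    set m := (a + b) / 2 with hm
    have hmI : m ∈ Set.Ioo a b := ⟨by linarith, by linarith⟩
    have hconst : ∀ c ∈ Set.Ioo a b, SignType.sign (p.derivative.eval c) = SignType.sign (p.derivative.eval m) := by
      intro c hcI
      by_contra hne
      obtain ⟨u, hu, hu0⟩ := dv_ivt p.derivative.continuous hne
      exact hc u ((Set.ordConnected_Ioo.uIcc_subset hcI hmI) hu) (hZ u hu0)
    have hm0 : p.derivative.eval m ≠ 0 := fun h => hc m hmI (hZ m h)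
    have hq : ∀ c ∈ Set.Ioo (φ a) (φ b), SignType.sign (q.derivative.eval c) = SignType.sign (p.derivative.eval m) := by
      intro c hcI
      have h1 : φ.symm c ∈ Set.Ioo a b := ⟨by rw [OrderIso.lt_symm_apply]; exact hcI.1, by rw [OrderIso.symm_apply_lt]; exact hcI.2⟩
      rw [← hconst _ h1, hd, OrderIso.apply_symm_apply]
    have hmaps : Set.MapsTo φ (Set.Icc a b) (Set.Icc (φ a) (φ b)) := fun x hx =>
      ⟨φ.monotone hx.1, φ.monotone hx.2⟩
    rcases lt_or_gt_of_ne hm0 with h | h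
    · right
      rw [sign_neg h] at hconst hq
      constructor
      · apply strictAntiOn_of_deriv_neg (convex_Icc a b) p.continuous.continuousOn
        intro x hx
        rw [interior_Icc] at hx
        rw [Polynomial.deriv]
        exact sign_eq_neg_one_iff.1 (hconst x hx)
      · have : StrictAntiOn (fun x => q.eval x) (Set.Icc (φ a) (φ b)) := by
          apply strictAntiOn_of_deriv_neg (convex_Icc _ _) q.continuous.continuousOn
          intro x hx
          rw [interior_Icc] at hx
          rw [Polynomial.deriv]
          exact sign_eq_neg_one_iff.1 (hq x hx)
        exact this.comp_strictMonoOn (φ.strictMono.strictMonoOn _) hmaps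
    · left
      rw [sign_pos h] at hconst hq
      constructor
      · apply strictMonoOn_of_deriv_pos (convex_Icc a b) p.continuous.continuousOn
        intro x hx
        rw [interior_Icc] at hx
        rw [Polynomial.deriv]
        exact sign_eq_one_iff.1 (hconst x hx)
      · have : StrictMonoOn (fun x => q.eval x) (Set.Icc (φ a) (φ b)) := by
          apply strictMonoOn_of_deriv_pos (convex_Icc _ _) q.continuous.continuousOn
          intro x hx
          rw [interior_Icc] at hx
          rw [Polynomial.deriv]
          exact sign_eq_one_iff.1 (hq x hx)
        exact this.comp (φ.strictMono.strictMonoOn _) hmaps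
  · intro t ht
    have hp0 : p ≠ 0 := by rintro rfl; simp at hp
    simp [hp0]
    exact ht

section alg
open Polynomial
variable {R : Type*} [CommRing R]

lemma dv_pdiv (q : R[X]) (hq : 0 < q.natDegree) : ∀ (n : ℕ) (p : R[X]), p.natDegree = n →
    ∃ (e : ℕ) (a r : R[X]), C q.leadingCoeff ^ e * p = a * q + r ∧ r.natDegree < q.natDegree := by
  intro n
  induction n using Nat.strong_induction_on with
  | _ n ih =>
    intro p hp
    by_cases h : p.natDegree < q.natDegree
    · exact ⟨0, 0, p, by simp, h⟩
    · push Not at h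
      have hlt : (q.cancelLeads p).natDegree < n := by
        rw [← hp]
        exact natDegree_cancelLeads_lt_of_natDegree_le_natDegree h (by omega)
      obtain ⟨e, a, r, h1, h2⟩ := ih _ hlt (q.cancelLeads p) rfl
      refine ⟨e + 1, a + C q.leadingCoeff ^ e * (C p.leadingCoeff * X ^ (p.natDegree - q.natDegree)), r, ?_, h2⟩
      have h3 : C q.leadingCoeff * p = q.cancelLeads p + C p.leadingCoeff * X ^ (p.natDegree - q.natDegree) * q := by
        rw [cancelLeads, Nat.sub_eq_zero_of_le h]; ring
      rw [pow_succ, mul_assoc, h3, mul_add, h1]; ring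

lemma dv_trunc : ∀ (n : ℕ) (q : R[X]), q.support.card = n →
    ∃ T : Finset R[X], (∀ q' ∈ T, q'.natDegree ≤ q.natDegree) ∧
      ∀ x y : R →+* ℝ, (∀ q' ∈ T, SignType.sign (x q'.leadingCoeff) = SignType.sign (y q'.leadingCoeff)) →
        (q.map x = 0 ∧ q.map y = 0) ∨
        ∃ q' ∈ T, q.map x = q'.map x ∧ q.map y = q'.map y ∧ x q'.leadingCoeff ≠ 0 := by
  classical
  intro n
  induction n with
  | zero =>
    intro q hq
    have : q = 0 := by simpa using hq
    subst this
    exact ⟨∅, by simp, fun x y _ => Or.inl (by simp)⟩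
  | succ n ih =>
    intro q hq
    have hc : q.eraseLead.support.card = n := by
      rw [eraseLead_support, Finset.card_erase_of_mem, hq]; simp
      apply natDegree_mem_support_of_nonzero
      rintro rfl; simp at hq
    obtain ⟨T, hT1, hT2⟩ := ih q.eraseLead hc
    refine ⟨insert q T, ?_, ?_⟩
    · intro q' hq'
      rcases Finset.mem_insert.1 hq' with rfl | h
      · exact le_rfl
      · exact (hT1 q' h).trans ((eraseLead_natDegree_le q).trans (Nat.sub_le _ _))
    · intro x y hxy
      by_cases h0 : x q.leadingCoeff = 0
      · have h1 := hxy q (Finset.mem_insert_self _ _)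
        have h2 : y q.leadingCoeff = 0 := by
          rw [h0, sign_zero] at h1; exact sign_eq_zero_iff.1 h1.symm
        have e : ∀ w : R →+* ℝ, w q.leadingCoeff = 0 → q.map w = q.eraseLead.map w := by
          intro w hw
          have hh := congrArg (map w) (eraseLead_add_C_mul_X_pow q)
          rw [← hh, Polynomial.map_add, Polynomial.map_mul, map_C, hw]; simp
        rw [e x h0, e y h2]
        rcases hT2 x y (fun q' hq' => hxy q' (Finset.mem_insert_of_mem hq')) with h | ⟨q', h, h'⟩
        · exact Or.inl h
        · exact Or.inr ⟨q', Finset.mem_insert_of_mem h, h'⟩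
      · exact Or.inr ⟨q, Finset.mem_insert_self _ _, rfl, rfl, h0⟩

lemma dv_rem (p q : R[X]) :
    ∃ (T : Finset R[X]) (K : Finset R), (∀ r ∈ T, r.natDegree < q.natDegree) ∧
      ∀ x y : R →+* ℝ, (∀ k ∈ K, SignType.sign (x k) = SignType.sign (y k)) →
        (q.map x = 0 ∧ q.map y = 0) ∨
        ∀ t s : ℝ, (q.map x).eval t = 0 → (q.map y).eval s = 0 →
          (∀ r ∈ T, SignType.sign ((r.map x).eval t) = SignType.sign ((r.map y).eval s)) →
          SignType.sign ((p.map x).eval t) = SignType.sign ((p.map y).eval s) := by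
  classical
  obtain ⟨T, hT1, hT2⟩ := dv_trunc _ q rfl
  have hrem : ∀ q' : R[X], ∃ r : R[X], 0 < q'.natDegree → ∃ (e : ℕ) (a : R[X]),
      C q'.leadingCoeff ^ e * p = a * q' + r ∧ r.natDegree < q'.natDegree := by
    intro q'
    by_cases h : 0 < q'.natDegree
    · obtain ⟨e, a, r, h⟩ := dv_pdiv q' h _ p rfl
      exact ⟨r, fun _ => ⟨e, a, h⟩⟩
    · exact ⟨0, fun h' => absurd h' h⟩
  choose rem hrem using hrem
  refine ⟨(T.filter (fun q' => 0 < q'.natDegree)).image rem, T.image leadingCoeff, ?_, ?_⟩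
  · intro r hr
    obtain ⟨q', hq', rfl⟩ := Finset.mem_image.1 hr
    rw [Finset.mem_filter] at hq'
    obtain ⟨e, a, -, h⟩ := hrem q' hq'.2
    exact h.trans_le (hT1 q' hq'.1)
  · intro x y hxy
    have hxy' : ∀ q' ∈ T, SignType.sign (x q'.leadingCoeff) = SignType.sign (y q'.leadingCoeff) :=
      fun q' hq' => hxy _ (Finset.mem_image_of_mem _ hq')
    rcases hT2 x y hxy' with h | ⟨q', hq', ex, ey, hne⟩
    · exact Or.inl h
    right
    intro t s ht hs hr
    rw [ex] at ht
    rw [ey] at hs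
    have hpos : 0 < q'.natDegree := by
      by_contra hcon
      have h0 : q'.natDegree = 0 := by omega
      rw [eq_C_of_natDegree_eq_zero h0] at ht
      simp at ht
      apply hne
      rw [leadingCoeff, h0]; exact ht
    obtain ⟨e, a, h, -⟩ := hrem q' hpos
    have key : ∀ (w : R →+* ℝ) (u : ℝ), (q'.map w).eval u = 0 →
        SignType.sign (w q'.leadingCoeff) ^ e * SignType.sign ((p.map w).eval u) = SignType.sign (((rem q').map w).eval u) := by
      intro w u hu
      have := congrArg (fun P => eval u (P.map w)) h
      simp only [Polynomial.map_mul, Polynomial.map_pow, Polynomial.map_add, map_C, eval_mul, eval_pow, eval_C, eval_add, hu, mul_zero, zero_add] at this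
      rw [← this, sign_mul, sign_pow]
    have k1 := key x t ht
    have k2 := key y s hs
    rw [hr _ (Finset.mem_image_of_mem _ (Finset.mem_filter.2 ⟨hq', hpos⟩)), ← k2, ← hxy' q' hq'] at k1
    have hu : SignType.sign (x q'.leadingCoeff) ^ e ≠ 0 := pow_ne_zero _ (by simpa [sign_eq_zero_iff] using hne)
    exact mul_left_cancel₀ hu k1

def DvGood (L : Finset R[X]) : Prop :=
  ∃ K : Finset R, ∀ x y : R →+* ℝ, (∀ k ∈ K, SignType.sign (x k) = SignType.sign (y k)) →
    ∃ φ : ℝ ≃o ℝ, ∀ p ∈ L, ∀ t, SignType.sign ((p.map x).eval t) = SignType.sign ((p.map y).eval (φ t))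

lemma dv_step [DecidableEq R[X]] (p : R[X]) (hp : 0 < p.natDegree) (A : Finset R[X])
    (hA : ∀ q ∈ A, q.natDegree ≤ p.natDegree) :
    ∃ B : Finset R[X], (∀ q ∈ B, q.natDegree < p.natDegree) ∧ (DvGood (A ∪ B) → DvGood (insert p A)) := by
  classical
  choose T K hT hK using fun q => dv_rem p q
  set A' := insert (derivative p) A with hA'
  have hder : p.derivative.natDegree < p.natDegree := natDegree_derivative_lt hp.ne'
  have hA'd : ∀ q ∈ A', q.natDegree ≤ p.natDegree := by
    intro q hq
    rcases Finset.mem_insert.1 hq with rfl | h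
    · exact hder.le
    · exact hA q h
  refine ⟨{p.derivative, p.eraseLead} ∪ A'.biUnion T, ?_, ?_⟩
  · intro q hq
    simp only [Finset.mem_union, Finset.mem_insert, Finset.mem_singleton, Finset.mem_biUnion] at hq
    rcases hq with (rfl | rfl) | ⟨q', hq', h⟩
    · exact hder
    · have := eraseLead_natDegree_le p; omega
    · exact (hT q' q h).trans_le (hA'd q' hq')
  · rintro ⟨K0, hK0⟩
    refine ⟨insert p.leadingCoeff (K0 ∪ A'.biUnion K), ?_⟩
    intro x y hxy
    obtain ⟨φ, hφ⟩ := hK0 x y (fun k hk => hxy k (by simp [hk]))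
    have hl := hxy p.leadingCoeff (by simp)
    by_cases h0 : x p.leadingCoeff = 0
    · have h2 : y p.leadingCoeff = 0 := by
        rw [h0, sign_zero] at hl; exact sign_eq_zero_iff.1 hl.symm
      have e : ∀ w : R →+* ℝ, w p.leadingCoeff = 0 → p.map w = p.eraseLead.map w := by
        intro w hw
        have hh := congrArg (map w) (eraseLead_add_C_mul_X_pow p)
        rw [← hh, Polynomial.map_add, Polynomial.map_mul, map_C, hw]; simp
      refine ⟨φ, ?_⟩
      intro q hq
      rcases Finset.mem_insert.1 hq with rfl | h
      · rw [e x h0, e y h2]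
        exact hφ _ (by simp)
      · exact hφ q (by simp [h])
    · have h2 : y p.leadingCoeff ≠ 0 := by
        intro h
        rw [h, sign_zero] at hl; exact h0 (sign_eq_zero_iff.1 hl)
      have dx := natDegree_map_of_leadingCoeff_ne_zero x h0
      have dy := natDegree_map_of_leadingCoeff_ne_zero y h2
      set Z : Finset ℝ := A'.biUnion (fun q => (q.map x).roots.toFinset) with hZ
      have hZmem : ∀ q ∈ A', ∀ t, q.map x ≠ 0 → (q.map x).eval t = 0 → t ∈ Z := by
        intro q hq t hne ht
        rw [hZ, Finset.mem_biUnion]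
        exact ⟨q, hq, by simp [hne, ht]⟩
      have hφ' : ∀ q ∈ A', ∀ t, SignType.sign ((q.map x).eval t) = SignType.sign ((q.map y).eval (φ t)) := by
        intro q hq
        apply hφ
        rcases Finset.mem_insert.1 hq with rfl | h
        · simp
        · simp [h]
      have hdne : p.derivative.map x ≠ 0 := by
        rw [← derivative_map]
        intro h
        have := derivative_eq_zero.1 h
        omega
      obtain ⟨ψ, h1, h3, h4⟩ := dv_poly (p.map x) (p.map y) φ Z (by omega) (by omega)
        (by rw [leadingCoeff_map_of_leadingCoeff_ne_zero x h0, leadingCoeff_map_of_leadingCoeff_ne_zero y h2, hl])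
        (by
          intro t ht
          rw [derivative_map] at ht
          exact hZmem _ (by simp [hA']) t hdne ht)
        (by
          intro t
          rw [derivative_map, derivative_map]
          exact hφ' _ (by simp [hA']) t)
        (by
          intro z hz
          rw [hZ, Finset.mem_biUnion] at hz
          obtain ⟨q, hq, hzq⟩ := hz
          simp at hzq
          have hqz : (q.map x).eval z = 0 := hzq.2
          rcases hK q x y (fun k hk => hxy k (by
            apply Finset.mem_insert_of_mem
            apply Finset.mem_union_right
            exact Finset.mem_biUnion.2 ⟨q, hq, hk⟩)) with h | h
          · exact absurd h.1 hzq.1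
          · apply h z (φ z) hqz
            · have := hφ' q hq z
              rw [hqz, sign_zero] at this
              exact sign_eq_zero_iff.1 this.symm
            · intro r hr
              apply hφ
              apply Finset.mem_union_right
              apply Finset.mem_union_right
              exact Finset.mem_biUnion.2 ⟨q, hq, hr⟩)
      refine ⟨ψ.trans φ, ?_⟩
      intro q hq t
      simp only [OrderIso.trans_apply]
      rcases Finset.mem_insert.1 hq with rfl | hqA
      · exact h4 t
      · have hqA' : q ∈ A' := Finset.mem_insert_of_mem hqA
        rw [← hφ' q hqA']
        by_cases htZ : t ∈ Z
        · rw [h3 t htZ]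
        · by_contra hne
          obtain ⟨c, hc, hc0⟩ := dv_ivt (q.map x).continuous hne
          have hcS := (h1 t htZ).between htZ hc
          apply hcS.notMem htZ
          apply hZmem q hqA' c _ hc0
          intro h
          rw [h] at hne
          simp at hne

lemma dv_good_const (L : Finset R[X]) (hL : ∀ p ∈ L, p.natDegree = 0) : DvGood L := by
  classical
  refine ⟨L.image (fun p => p.coeff 0), fun x y hxy => ⟨OrderIso.refl ℝ, fun p hp t => ?_⟩⟩
  have := hxy _ (Finset.mem_image_of_mem (fun p : R[X] => p.coeff 0) hp)
  rw [eq_C_of_natDegree_eq_zero (hL p hp)]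
  simpa using this

lemma dv_good (n : ℕ) : ∀ L : Finset R[X], (∀ p ∈ L, p.natDegree ≤ n) → DvGood L := by
  classical
  induction n with
  | zero => exact fun L hL => dv_good_const L (fun p hp => by have := hL p hp; omega)
  | succ n ih =>
    have main : ∀ A : Finset R[X], (∀ p ∈ A, p.natDegree = n + 1) →
        ∀ B : Finset R[X], (∀ p ∈ B, p.natDegree ≤ n) → DvGood (A ∪ B) := by
      intro A
      induction A using Finset.induction_on with
      | empty => intro _ B hB; simpa using ih B hB
      | insert p A hpA ihA =>
        intro hA B hB
        have hp := hA p (Finset.mem_insert_self _ _)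
        obtain ⟨B', hB', hstep⟩ := dv_step p (by omega) (A ∪ B) (by
          intro q hq
          rcases Finset.mem_union.1 hq with h | h
          · rw [hA q (Finset.mem_insert_of_mem h), hp]
          · have := hB q h; omega)
        rw [Finset.insert_union]
        apply hstep
        rw [Finset.union_assoc]
        apply ihA (fun q hq => hA q (Finset.mem_insert_of_mem hq))
        intro q hq
        rcases Finset.mem_union.1 hq with h | h
        · exact hB q h
        · have := hB' q h; omega
    intro L hL
    have := main (L.filter (fun p => p.natDegree = n + 1)) (by simp)
      (L.filter (fun p => ¬ p.natDegree = n + 1)) (by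
        intro p hp
        rw [Finset.mem_filter] at hp
        have := hL p hp.1
        omega)
    rwa [Finset.filter_union_filter_not_eq] at this

lemma dv_good_all (L : Finset R[X]) : DvGood L :=
  dv_good (L.sup natDegree) L (fun _ hp => Finset.le_sup (f := natDegree) hp)

end alg

lemma dv_tarski (n : ℕ) {R : Type*} [CommRing R] : ∀ L : Finset (MvPolynomial (Fin n) R),
    ∃ K : Finset R, ∀ x y : R →+* ℝ, (∀ k ∈ K, SignType.sign (x k) = SignType.sign (y k)) →
      ∀ u : Fin n → ℝ, ∃ v : Fin n → ℝ, ∀ p ∈ L,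
        SignType.sign (MvPolynomial.eval₂ x u p) = SignType.sign (MvPolynomial.eval₂ y v p) := by
  classical
  induction n with
  | zero =>
    intro L
    refine ⟨L.image (fun p => p.coeff 0), fun x y hxy u => ⟨u, fun p hp => ?_⟩⟩
    have := hxy _ (Finset.mem_image_of_mem (fun p : MvPolynomial (Fin 0) R => p.coeff 0) hp)
    rw [MvPolynomial.eq_C_of_isEmpty p]
    simpa using this
  | succ n ih =>
    intro L
    obtain ⟨K1, hK1⟩ := dv_good_all (L.image (MvPolynomial.finSuccEquiv R n))
    obtain ⟨K, hK⟩ := ih K1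
    have key : ∀ (x : R →+* ℝ) (u : Fin (n+1) → ℝ) (p : MvPolynomial (Fin (n+1)) R),
        MvPolynomial.eval₂ x u p =
          ((MvPolynomial.finSuccEquiv R n p).map (MvPolynomial.eval₂Hom x (fun i => u i.succ))).eval (u 0) := by
      intro x u p
      induction p using MvPolynomial.induction_on with
      | C a => simp [MvPolynomial.finSuccEquiv_apply]
      | add p q hp hq => simp [hp, hq]
      | mul_X p i hp =>
        rw [MvPolynomial.eval₂_mul, hp, map_mul, Polynomial.map_mul, Polynomial.eval_mul, MvPolynomial.eval₂_X]
        congr 1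
        refine Fin.cases ?_ (fun j => ?_) i
        · rw [MvPolynomial.finSuccEquiv_X_zero]; simp
        · rw [MvPolynomial.finSuccEquiv_X_succ]; simp
    refine ⟨K, fun x y hxy u => ?_⟩
    obtain ⟨v, hv⟩ := hK x y hxy (fun i => u i.succ)
    obtain ⟨φ, hφ⟩ := hK1 (MvPolynomial.eval₂Hom x (fun i => u i.succ)) (MvPolynomial.eval₂Hom y v) (by simpa using hv)
    refine ⟨Fin.cons (φ (u 0)) v, fun p hp => ?_⟩
    rw [key, key, hφ _ (Finset.mem_image_of_mem _ hp)]
    simp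

def DvTame (h : ℕ) (E : Set ℝ) : Prop :=
  ∃ B : Finset ℝ, B.card ≤ h ∧ ∀ a b, a ≤ b → (∀ c ∈ Set.Icc a b, c ∉ B) → (a ∈ E ↔ b ∈ E)

lemma DvTame.mono {h h' : ℕ} (hh : h ≤ h') {E : Set ℝ} (hE : DvTame h E) : DvTame h' E := by
  obtain ⟨B, hB, h1⟩ := hE
  exact ⟨B, hB.trans hh, h1⟩

lemma dv_tame_family {X : Type} (n : ℕ) (L : Finset (MvPolynomial (Fin n) (Polynomial (X → ℝ)))) :
    ∃ h : ℕ, ∀ (x : X) (E : Set ℝ),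
      (∀ t t' : ℝ, (∀ u : Fin n → ℝ, ∃ v : Fin n → ℝ, ∀ p ∈ L,
        SignType.sign (MvPolynomial.eval₂ (Polynomial.eval₂RingHom (Pi.evalRingHom _ x) t) u p) =
        SignType.sign (MvPolynomial.eval₂ (Polynomial.eval₂RingHom (Pi.evalRingHom _ x) t') v p)) →
        t ∈ E → t' ∈ E) → DvTame h E := by
  classical
  obtain ⟨K, hK⟩ := dv_tarski n L
  refine ⟨∑ k ∈ K, k.natDegree, fun x E hE => ?_⟩
  refine ⟨K.biUnion (fun k => (k.map (Pi.evalRingHom (fun _ : X => ℝ) x)).roots.toFinset), ?_, ?_⟩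
  · refine Finset.card_biUnion_le.trans (Finset.sum_le_sum fun k _ => ?_)
    exact (Multiset.toFinset_card_le _).trans
      ((Polynomial.card_roots' _).trans Polynomial.natDegree_map_le)
  · intro a b hab hc
    have hev : ∀ (k : Polynomial (X → ℝ)) (t : ℝ),
        (Polynomial.eval₂RingHom (Pi.evalRingHom (fun _ : X => ℝ) x) t) k =
          (k.map (Pi.evalRingHom (fun _ : X => ℝ) x)).eval t := by
      intro k t
      rw [Polynomial.coe_eval₂RingHom, Polynomial.eval_map]
    have hsame : ∀ k ∈ K, SignType.sign ((Polynomial.eval₂RingHom (Pi.evalRingHom (fun _ : X => ℝ) x) a) k) =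
        SignType.sign ((Polynomial.eval₂RingHom (Pi.evalRingHom (fun _ : X => ℝ) x) b) k) := by
      intro k hk
      rw [hev, hev]
      by_contra hne
      obtain ⟨c, hcI, hc0⟩ := dv_ivt (Polynomial.continuous _) hne
      rw [Set.uIcc_of_le hab] at hcI
      apply hc c hcI
      rw [Finset.mem_biUnion]
      refine ⟨k, hk, ?_⟩
      rw [Multiset.mem_toFinset, Polynomial.mem_roots']
      refine ⟨?_, hc0⟩
      intro h0
      rw [h0] at hne
      simp at hne
    exact ⟨hE a b (hK _ _ hsame), hE b a (hK _ _ fun k hk => (hsame k hk).symm)⟩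

lemma dv_tame_one (d k m : ℕ) (I : Finset (Fin d)) (j : Fin d) :
    ∃ h : ℕ, ∀ (F : Fin k → MvPolynomial (Fin d) ℝ), (∀ i, (F i).totalDegree ≤ m) →
      ∀ z : Fin d → ℝ,
      DvTame h {t | ∃ u : Fin d → ℝ, (∀ i, 0 ≤ MvPolynomial.eval u (F i)) ∧ u j = t ∧ ∀ i ∈ I, u i = z i} := by
  classical
  let X := (Fin k → MvPolynomial (Fin d) ℝ) × (Fin d → ℝ)
  have hfin : {s : Fin d →₀ ℕ | s.degree ≤ m}.Finite := Finsupp.finite_of_degree_le m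
  let P : Fin k → MvPolynomial (Fin d) (Polynomial (X → ℝ)) := fun i =>
    ∑ s ∈ hfin.toFinset, MvPolynomial.monomial s (Polynomial.C (fun x : X => MvPolynomial.coeff s (x.1 i)))
  let Q : MvPolynomial (Fin d) (Polynomial (X → ℝ)) := MvPolynomial.X j - MvPolynomial.C Polynomial.X
  let Y : Fin d → MvPolynomial (Fin d) (Polynomial (X → ℝ)) := fun i =>
    MvPolynomial.X i - MvPolynomial.C (Polynomial.C (fun x : X => x.2 i))
  obtain ⟨h, hh⟩ := dv_tame_family (X := X) d (Finset.univ.image P ∪ {Q} ∪ I.image Y)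
  refine ⟨h, fun F hF z => hh (F, z) _ ?_⟩
  have eP : ∀ i t u, MvPolynomial.eval₂ (Polynomial.eval₂RingHom (Pi.evalRingHom (fun _ : X => ℝ) (F, z)) t) u (P i)
      = MvPolynomial.eval u (F i) := by
    intro i t u
    rw [MvPolynomial.eval_eq', MvPolynomial.eval₂_sum]
    have : (F i).support ⊆ hfin.toFinset := by
      intro s hs
      simp only [Set.Finite.mem_toFinset, Set.mem_setOf_eq]
      exact (MvPolynomial.le_totalDegree hs).trans (hF i)
    rw [Finset.sum_subset this]
    · apply Finset.sum_congr rfl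
      intro s _
      rw [MvPolynomial.eval₂_monomial]
      simp [Finsupp.prod_fintype]
    · intro s _ hs
      rw [MvPolynomial.notMem_support_iff.1 hs, zero_mul]
  have eQ : ∀ t u, MvPolynomial.eval₂ (Polynomial.eval₂RingHom (Pi.evalRingHom (fun _ : X => ℝ) (F, z)) t) u Q
      = u j - t := by
    intro t u
    simp [Q, MvPolynomial.eval₂_sub]
  have eY : ∀ i t u, MvPolynomial.eval₂ (Polynomial.eval₂RingHom (Pi.evalRingHom (fun _ : X => ℝ) (F, z)) t) u (Y i)
      = u i - z i := by
    intro i t u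
    simp [Y, MvPolynomial.eval₂_sub]
  rintro t t' hyp ⟨u, hu1, hu2, hu3⟩
  obtain ⟨v, hv⟩ := hyp u
  refine ⟨v, ?_, ?_, ?_⟩
  · intro i
    have := hv (P i) (by simp)
    rw [eP, eP] at this
    rw [← sign_nonneg_iff, ← this, sign_nonneg_iff]
    exact hu1 i
  · have := hv Q (by simp)
    rw [eQ, eQ, hu2, sub_self, sign_zero] at this
    have := sign_eq_zero_iff.1 this.symm
    linarith
  · intro i hi
    have := hv (Y i) (Finset.mem_union_right _ (Finset.mem_image_of_mem _ hi))
    rw [eY, eY, hu3 i hi, sub_self, sign_zero] at this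
    have := sign_eq_zero_iff.1 this.symm
    linarith

lemma dv_tame_all (d k m : ℕ) :
    ∃ h : ℕ, ∀ (F : Fin k → MvPolynomial (Fin d) ℝ), (∀ i, (F i).totalDegree ≤ m) →
      ∀ (I : Finset (Fin d)) (j : Fin d) (z : Fin d → ℝ),
      DvTame h {t | ∃ u ∈ {x : Fin d → ℝ | ∀ i, 0 ≤ MvPolynomial.eval x (F i)}, u j = t ∧ ∀ i ∈ I, u i = z i} := by
  choose h hh using dv_tame_one d k m
  refine ⟨Finset.univ.sup (fun p : Finset (Fin d) × Fin d => h p.1 p.2), fun F hF I j z => ?_⟩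
  exact (hh I j F hF z).mono (Finset.le_sup (f := fun p : Finset (Fin d) × Fin d => h p.1 p.2) (Finset.mem_univ (I, j)))

open scoped ENNReal

noncomputable def dvNu : Measure ℝ := (Measure.count : Measure ℤ).map (fun n : ℤ => (n : ℝ))

lemma dv_emb : MeasurableEmbedding (fun n : ℤ => (n : ℝ)) :=
  Int.isClosedEmbedding_coe_real.measurableEmbedding

instance dvNu_sf : SigmaFinite dvNu := dv_emb.sigmaFinite_map

lemma dvNu_apply (E : Set ℝ) : dvNu E = ∑' n : ℤ, E.indicator (fun _ => (1 : ℝ≥0∞)) (n : ℝ) := by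
  rw [dvNu, dv_emb.map_apply, ← lintegral_indicator_one (MeasurableSet.of_discrete), lintegral_count]
  rfl

lemma dv_one_dim {h : ℕ} {E : Set ℝ} (hE : MeasurableSet E) (hT : DvTame h E) :
    volume E ≤ dvNu E + h ∧ dvNu E ≤ volume E + h := by
  classical
  obtain ⟨B, hB, hconst⟩ := hT
  have hvol : volume E = ∑' n : ℤ, volume (E ∩ Set.Ico (n : ℝ) (n + 1)) := by
    rw [← measure_iUnion]
    · rw [← Set.inter_iUnion, iUnion_Ico_intCast, Set.inter_univ]
    · intro a b hab
      exact (Set.pairwise_disjoint_Ico_intCast ℝ hab).mono Set.inter_subset_right Set.inter_subset_right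
    · exact fun n => hE.inter measurableSet_Ico
  have hB' : ∑' n : ℤ, ∑ b ∈ B, (if n = ⌊b⌋ then (1 : ℝ≥0∞) else 0) ≤ h := by
    rw [Summable.tsum_finsetSum (fun _ _ => ENNReal.summable)]
    simp only [tsum_ite_eq, Finset.sum_const, nsmul_eq_mul, mul_one]
    exact_mod_cast hB
  have hico : ∀ n : ℤ, volume (Set.Ico (n : ℝ) (n + 1)) = 1 := by
    intro n; rw [Real.volume_Ico]; simp
  have key : ∀ n : ℤ, (volume (E ∩ Set.Ico (n : ℝ) (n + 1)) = E.indicator (fun _ => (1 : ℝ≥0∞)) (n : ℝ)) ∨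
      1 ≤ ∑ b ∈ B, (if n = ⌊b⌋ then (1 : ℝ≥0∞) else 0) := by
    intro n
    by_cases hb : ∃ b ∈ B, n = ⌊b⌋
    · obtain ⟨b, hbB, hn⟩ := hb
      right
      calc (1 : ℝ≥0∞) = (if n = ⌊b⌋ then (1 : ℝ≥0∞) else 0) := by simp [hn]
        _ ≤ _ := Finset.single_le_sum (f := fun b => (if n = ⌊b⌋ then (1 : ℝ≥0∞) else 0)) (fun _ _ => zero_le) hbB
    · left
      push Not at hb
      have hiff : ∀ t ∈ Set.Ico (n : ℝ) (n + 1), ((n : ℝ) ∈ E ↔ t ∈ E) := by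
        intro t ht
        apply hconst _ _ ht.1
        intro c hc hcB
        apply hb c hcB
        symm
        rw [Int.floor_eq_iff]
        exact ⟨hc.1, lt_of_le_of_lt hc.2 ht.2⟩
      by_cases hn : (n : ℝ) ∈ E
      · rw [Set.indicator_of_mem hn, Set.inter_eq_right.2 (fun t ht => (hiff t ht).1 hn), hico]
      · rw [Set.indicator_of_notMem hn]
        have : E ∩ Set.Ico (n : ℝ) (n + 1) = ∅ := by
          ext t
          simp only [Set.mem_inter_iff, Set.mem_empty_iff_false, iff_false]
          rintro ⟨h1, h2⟩
          exact hn ((hiff t h2).2 h1)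
        rw [this, measure_empty]
  constructor
  · rw [hvol, dvNu_apply]
    refine le_trans ?_ (add_le_add_right hB' _)
    rw [← ENNReal.tsum_add]
    refine ENNReal.tsum_le_tsum fun n => ?_
    rcases key n with h1 | h1
    · rw [h1]; exact le_self_add
    · refine le_trans ?_ (h1.trans le_add_self)
      exact (measure_mono Set.inter_subset_right).trans (hico n).le
  · rw [hvol, dvNu_apply]
    refine le_trans ?_ (add_le_add_right hB' _)
    rw [← ENNReal.tsum_add]
    refine ENNReal.tsum_le_tsum fun n => ?_
    rcases key n with h1 | h1
    · rw [h1]; exact le_self_add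
    · refine le_trans ?_ (h1.trans le_add_self)
      exact Set.indicator_le_self' (fun _ _ => zero_le) _

section dav
variable {d : ℕ} {D : Set (Fin d → ℝ)}

def dvP (D : Set (Fin d → ℝ)) (J : Finset (Fin d)) : Set (Fin d → ℝ) := {z | ∃ x ∈ D, ∀ j ∈ J, x j = z j}

lemma dvP_closed (hD : IsCompact D) (J : Finset (Fin d)) : IsClosed (dvP D J) := by
  have hc : Continuous (fun (x : Fin d → ℝ) (j : {j // j ∈ J}) => x j) := by fun_prop
  have := (hD.image hc).isClosed.preimage hc
  convert this using 1
  ext z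
  simp only [dvP, Set.mem_setOf_eq, Set.mem_preimage, Set.mem_image, funext_iff, Subtype.forall]

noncomputable def dvM (D : Set (Fin d → ℝ)) (μ : Fin d → Measure ℝ) (J : Finset (Fin d)) : ℝ≥0∞ :=
  lmarginal μ J ((dvP D J).indicator 1) 0

lemma dvM_congr (μ μ' : Fin d → Measure ℝ) (J : Finset (Fin d)) (h : ∀ j ∈ J, μ j = μ' j) :
    dvM D μ J = dvM D μ' J := by
  have : (fun i : {j // j ∈ J} => μ i) = fun i : {j // j ∈ J} => μ' i := by
    funext i; exact h i i.2
  rw [dvM, dvM, lmarginal, lmarginal, this]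

lemma dv_lm_congr (μ μ' : Fin d → Measure ℝ) (J : Finset (Fin d)) (h : ∀ j ∈ J, μ j = μ' j)
    (f : (Fin d → ℝ) → ℝ≥0∞) : lmarginal μ J f = lmarginal μ' J f := by
  have : (fun i : {j // j ∈ J} => μ i) = fun i : {j // j ∈ J} => μ' i := by
    funext i; exact h i i.2
  funext x
  rw [lmarginal, lmarginal, this]

lemma dv_lm_add (μ : Fin d → Measure ℝ) (J : Finset (Fin d))
    (f g : (Fin d → ℝ) → ℝ≥0∞) (hg : Measurable g) (c : ℝ≥0∞) (x : Fin d → ℝ) :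
    lmarginal μ J (fun z => f z + c * g z) x = lmarginal μ J f x + c * lmarginal μ J g x := by
  have hm : Measurable (fun y : (i : {j // j ∈ J}) → ℝ => g (Function.updateFinset x J y)) :=
    hg.comp measurable_updateFinset
  rw [lmarginal, lmarginal, lmarginal, lintegral_add_right _ (hm.const_mul c), lintegral_const_mul _ hm]

lemma dv_inner (hD : IsCompact D) (J : Finset (Fin d)) (i : Fin d) (hi : i ∉ J) (ρ : Measure ℝ)
    (z : Fin d → ℝ) :
    MeasurableSet {t | ∃ x ∈ D, x i = t ∧ ∀ j ∈ J, x j = z j} ∧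
    ∫⁻ t, (dvP D (insert i J)).indicator 1 (Function.update z i t) ∂ρ =
      ρ {t | ∃ x ∈ D, x i = t ∧ ∀ j ∈ J, x j = z j} := by
  have hset : {t | ∃ x ∈ D, x i = t ∧ ∀ j ∈ J, x j = z j} =
      (fun t => Function.update z i t) ⁻¹' (dvP D (insert i J)) := by
    ext t
    simp only [dvP, Set.mem_setOf_eq, Set.mem_preimage, Finset.forall_mem_insert, Function.update_self]
    refine exists_congr fun x => and_congr_right fun _ => and_congr_right fun _ => ?_
    refine forall₂_congr fun j hj => ?_
    have hne : j ≠ i := fun e => hi (e ▸ hj)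
    rw [Function.update_of_ne hne]
  have hcl : IsClosed {t | ∃ x ∈ D, x i = t ∧ ∀ j ∈ J, x j = z j} := by
    rw [hset]
    exact (dvP_closed hD _).preimage (continuous_const.update i continuous_id)
  refine ⟨hcl.measurableSet, ?_⟩
  rw [← lintegral_indicator_one hcl.measurableSet]
  congr 1
  funext t
  rw [hset]
  rfl

lemma dv_mstep (hD : IsCompact D) {h : ℕ}
    (hT : ∀ (I : Finset (Fin d)) (j : Fin d) (z : Fin d → ℝ),
      DvTame h {t | ∃ u ∈ D, u j = t ∧ ∀ i ∈ I, u i = z i})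
    (μ μ' : Fin d → Measure ℝ) [∀ i, SigmaFinite (μ i)] [∀ i, SigmaFinite (μ' i)]
    (J : Finset (Fin d)) (i : Fin d) (hi : i ∉ J) (hμ : ∀ j ∈ J, μ j = μ' j)
    (h1 : μ i = dvNu) (h2 : μ' i = volume) :
    dvM D μ (insert i J) ≤ dvM D μ' (insert i J) + h * dvM D μ' J ∧
    dvM D μ' (insert i J) ≤ dvM D μ (insert i J) + h * dvM D μ' J := by
  have hmeas : ∀ J, Measurable ((dvP D J).indicator (1 : (Fin d → ℝ) → ℝ≥0∞)) := fun J =>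
    measurable_one.indicator (dvP_closed hD J).measurableSet
  have key : ∀ z : Fin d → ℝ,
      volume {t | ∃ x ∈ D, x i = t ∧ ∀ j ∈ J, x j = z j} ≤
        dvNu {t | ∃ x ∈ D, x i = t ∧ ∀ j ∈ J, x j = z j} + h * (dvP D J).indicator 1 z ∧
      dvNu {t | ∃ x ∈ D, x i = t ∧ ∀ j ∈ J, x j = z j} ≤
        volume {t | ∃ x ∈ D, x i = t ∧ ∀ j ∈ J, x j = z j} + h * (dvP D J).indicator 1 z := by
    intro z
    by_cases hz : z ∈ dvP D J
    · rw [Set.indicator_of_mem hz]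
      simpa using dv_one_dim (dv_inner hD J i hi volume z).1 (hT J i z)
    · have : {t | ∃ x ∈ D, x i = t ∧ ∀ j ∈ J, x j = z j} = ∅ := by
        ext t
        simp only [Set.mem_setOf_eq, Set.mem_empty_iff_false, iff_false]
        rintro ⟨x, hx, -, hj⟩
        exact hz ⟨x, hx, hj⟩
      rw [this]; simp
  have e1 : dvM D μ (insert i J) = lmarginal μ' J
      (fun z => dvNu {t | ∃ x ∈ D, x i = t ∧ ∀ j ∈ J, x j = z j}) 0 := by
    rw [dvM, lmarginal_insert' _ (hmeas _) hi, dv_lm_congr μ μ' J hμ]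
    congr 1
    funext z
    rw [h1]; exact (dv_inner hD J i hi dvNu z).2
  have e2 : dvM D μ' (insert i J) = lmarginal μ' J
      (fun z => volume {t | ∃ x ∈ D, x i = t ∧ ∀ j ∈ J, x j = z j}) 0 := by
    rw [dvM, lmarginal_insert' _ (hmeas _) hi]
    congr 1
    funext z
    rw [h2]; exact (dv_inner hD J i hi volume z).2
  rw [e1, e2, dvM, ← dv_lm_add _ _ _ _ (hmeas J), ← dv_lm_add _ _ _ _ (hmeas J)]
  exact ⟨lmarginal_mono (fun z => (key z).2) 0, lmarginal_mono (fun z => (key z).1) 0⟩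

noncomputable def dvMu (A : Finset (Fin d)) (j : Fin d) : Measure ℝ := if j ∈ A then dvNu else volume

instance dvMu_sf (A : Finset (Fin d)) (j : Fin d) : SigmaFinite (dvMu A j) := by
  unfold dvMu; split_ifs <;> infer_instance

lemma dvMu_empty : dvMu (∅ : Finset (Fin d)) = fun _ => volume := by
  funext j; simp [dvMu]

lemma dv_bound (hD : IsCompact D) {h : ℕ}
    (hT : ∀ (I : Finset (Fin d)) (j : Fin d) (z : Fin d → ℝ),
      DvTame h {t | ∃ u ∈ D, u j = t ∧ ∀ i ∈ I, u i = z i}) (W : ℝ≥0∞)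
    (hW : ∀ J : Finset (Fin d), J ≠ Finset.univ → dvM D (fun _ => volume) J ≤ W)
    (A : Finset (Fin d)) : ∀ J : Finset (Fin d), J ≠ Finset.univ →
      dvM D (dvMu A) J ≤ (1 + h) ^ A.card * W := by
  induction A using Finset.induction_on with
  | empty => intro J hJ; simpa [dvMu_empty] using hW J hJ
  | insert i A hiA ih =>
    intro J hJ
    rw [Finset.card_insert_of_notMem hiA]
    by_cases hiJ : i ∈ J
    · have hne : J.erase i ≠ Finset.univ := by
        intro e
        have := Finset.mem_univ i
        rw [← e] at this
        simp at this
      have := (dv_mstep hD hT (dvMu (insert i A)) (dvMu A) (J.erase i) i (by simp)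
        (by intro j hj; have := Finset.ne_of_mem_erase hj; simp [dvMu, this]) (by simp [dvMu]) (by simp [dvMu, hiA])).1
      rw [Finset.insert_erase hiJ] at this
      calc _ ≤ _ := this
        _ ≤ (1 + h) ^ A.card * W + h * ((1 + h) ^ A.card * W) := by
          gcongr
          · exact ih J hJ
          · exact ih _ hne
        _ = _ := by ring
    · rw [dvM_congr (dvMu (insert i A)) (dvMu A) J (by
        intro j hj
        have : j ≠ i := fun e => hiJ (e ▸ hj)
        simp [dvMu, this])]
      refine (ih J hJ).trans ?_
      gcongr
      · exact le_self_add
      · omega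

lemma dv_tele (hD : IsCompact D) {h : ℕ}
    (hT : ∀ (I : Finset (Fin d)) (j : Fin d) (z : Fin d → ℝ),
      DvTame h {t | ∃ u ∈ D, u j = t ∧ ∀ i ∈ I, u i = z i}) (W : ℝ≥0∞)
    (hW : ∀ J : Finset (Fin d), J ≠ Finset.univ → dvM D (fun _ => volume) J ≤ W)
    (A : Finset (Fin d)) :
    dvM D (dvMu A) Finset.univ ≤ dvM D (fun _ => volume) Finset.univ + A.card * (h * ((1 + h) ^ d * W)) ∧
    dvM D (fun _ => volume) Finset.univ ≤ dvM D (dvMu A) Finset.univ + A.card * (h * ((1 + h) ^ d * W)) := by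
  induction A using Finset.induction_on with
  | empty => simp [dvMu_empty]
  | insert i A hiA ih =>
    rw [Finset.card_insert_of_notMem hiA]
    have hne : Finset.univ.erase i ≠ Finset.univ := by
      intro e
      have := Finset.mem_univ i
      rw [← e] at this
      simp at this
    have := (dv_mstep hD hT (dvMu (insert i A)) (dvMu A) (Finset.univ.erase i) i (by simp)
        (by intro j hj; have := Finset.ne_of_mem_erase hj; simp [dvMu, this]) (by simp [dvMu]) (by simp [dvMu, hiA]))
    rw [Finset.insert_erase (Finset.mem_univ i)] at this
    have hb : dvM D (dvMu A) (Finset.univ.erase i) ≤ (1 + h) ^ d * W := by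
      refine (dv_bound hD hT W hW A _ hne).trans ?_
      gcongr
      · exact le_self_add
      · simpa using A.card_le_univ
    have hb' : h * dvM D (dvMu A) (Finset.univ.erase i) ≤ h * ((1 + h) ^ d * W) := by gcongr
    constructor
    · calc _ ≤ _ := this.1
        _ ≤ (dvM D (fun _ => volume) Finset.univ + A.card * (h * ((1 + h) ^ d * W))) + h * ((1 + h) ^ d * W) :=
          add_le_add ih.1 hb'
        _ = _ := by push_cast; ring
    · calc _ ≤ _ := ih.2
        _ ≤ (dvM D (dvMu (insert i A)) Finset.univ + h * ((1 + h) ^ d * W)) + A.card * (h * ((1 + h) ^ d * W)) := by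
          gcongr
          exact this.2.trans (by gcongr)
        _ = _ := by push_cast; ring

lemma dvM_univ (hD : IsCompact D) (μ : Fin d → Measure ℝ) [∀ i, SigmaFinite (μ i)] :
    dvM D μ Finset.univ = Measure.pi μ D := by
  have : dvP D Finset.univ = D := by
    ext z
    constructor
    · rintro ⟨x, hx, h⟩
      have : x = z := funext fun j => h j (Finset.mem_univ j)
      exact this ▸ hx
    · exact fun hz => ⟨z, hz, fun _ _ => rfl⟩
  rw [dvM, this, lmarginal_univ, lintegral_indicator_one hD.measurableSet]

lemma dvM_vol (hD : IsCompact D) (J : Finset (Fin d)) :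
    dvM D (fun _ => volume) J = volume {z : {j // j ∈ J} → ℝ | ∃ x ∈ D, ∀ j : {j // j ∈ J}, z j = x ↑j} := by
  have hset : {z : {j // j ∈ J} → ℝ | ∃ x ∈ D, ∀ j : {j // j ∈ J}, z j = x ↑j} =
      (fun y => Function.updateFinset (0 : Fin d → ℝ) J y) ⁻¹' (dvP D J) := by
    ext z
    simp only [dvP, Set.mem_setOf_eq, Set.mem_preimage, Subtype.forall]
    refine exists_congr fun x => and_congr_right fun _ => forall₂_congr fun j hj => ?_
    rw [Function.updateFinset, dif_pos hj, eq_comm]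
  have hm : MeasurableSet ((fun y => Function.updateFinset (0 : Fin d → ℝ) J y) ⁻¹' (dvP D J)) :=
    measurable_updateFinset (dvP_closed hD J).measurableSet
  rw [hset, volume_pi, ← lintegral_indicator_one hm]
  rfl

lemma dv_pi_nu (hD : IsCompact D) :
    Measure.pi (fun _ : Fin d => dvNu) D = ({y : Fin d → ℤ | (fun j => (y j : ℝ)) ∈ D}.encard : ℝ≥0∞) := by
  have hcount : Measure.pi (fun _ : Fin d => (Measure.count : Measure ℤ)) = Measure.count := by
    apply Measure.ext_of_singleton
    intro a
    simp
  have : Measure.pi (fun _ : Fin d => dvNu) = (Measure.count : Measure (Fin d → ℤ)).map (fun y j => (y j : ℝ)) := by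
    rw [← hcount]
    haveI : ∀ i : Fin d, SigmaFinite ((Measure.count : Measure ℤ).map (fun n : ℤ => (n : ℝ))) := fun _ => dvNu_sf
    exact (Measure.pi_map_pi (Y := fun _ => ℝ) (hμ := fun _ => dvNu_sf) (μ := fun _ : Fin d => (Measure.count : Measure ℤ))
      (f := fun _ (n : ℤ) => (n : ℝ)) (fun _ => measurable_from_top.aemeasurable)).symm
  have hm : Measurable (fun (y : Fin d → ℤ) (j : Fin d) => (y j : ℝ)) :=
    measurable_pi_lambda _ fun j => measurable_from_top.comp (measurable_pi_apply j)
  rw [this, Measure.map_apply hm hD.measurableSet, Measure.count_apply (hm hD.measurableSet)]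
  rfl

end dav

theorem davenport_counting_lemma (d k m : ℕ) :
    ∃ C : ℝ, 0 < C ∧
      ∀ F : Fin k → MvPolynomial (Fin d) ℝ, (∀ i, (F i).totalDegree ≤ m) →
        ∀ D : Set (Fin d → ℝ), D = {x | ∀ i, 0 ≤ MvPolynomial.eval x (F i)} →
          Bornology.IsBounded D →
          |({y : Fin d → ℤ | (fun j => (y j : ℝ)) ∈ D}.ncard : ℝ) - (volume D).toReal| ≤
            C * max
              (⨆ J ∈ {J : Finset (Fin d) | 1 ≤ J.card ∧ J.card ≤ d - 1},
                (volume {z : {j // j ∈ J} → ℝ | ∃ x ∈ D, ∀ j : {j // j ∈ J}, z j = x ↑j}).toReal)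
              1 := by
  obtain ⟨h, hh⟩ := dv_tame_all d k m
  refine ⟨d * (h * (1 + h) ^ d) + 1, by positivity, ?_⟩
  intro F hF D hDF hbd
  have hT := hh F hF
  rw [← hDF] at hT
  have hcl : IsClosed D := by
    rw [hDF, Set.setOf_forall]
    exact isClosed_iInter fun i => isClosed_le continuous_const (MvPolynomial.continuous_eval (F i))
  have hD : IsCompact D := Metric.isCompact_of_isClosed_isBounded hcl hbd
  set V := max
              (⨆ J ∈ {J : Finset (Fin d) | 1 ≤ J.card ∧ J.card ≤ d - 1},
                (volume {z : {j // j ∈ J} → ℝ | ∃ x ∈ D, ∀ j : {j // j ∈ J}, z j = x ↑j}).toReal)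
              1 with hV
  have hV1 : 1 ≤ V := le_max_right _ _
  have hfinJ : ∀ J : Finset (Fin d),
      volume {z : {j // j ∈ J} → ℝ | ∃ x ∈ D, ∀ j : {j // j ∈ J}, z j = x ↑j} < ⊤ := by
    intro J
    have hc : Continuous (fun (x : Fin d → ℝ) (j : {j // j ∈ J}) => x j) := by fun_prop
    have : {z : {j // j ∈ J} → ℝ | ∃ x ∈ D, ∀ j : {j // j ∈ J}, z j = x ↑j} =
        (fun (x : Fin d → ℝ) (j : {j // j ∈ J}) => x j) '' D := by
      ext z
      simp only [Set.mem_setOf_eq, Set.mem_image, funext_iff, eq_comm]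
    rw [this]
    exact (hD.image hc).measure_lt_top
  have hW : ∀ J : Finset (Fin d), J ≠ Finset.univ → dvM D (fun _ => volume) J ≤ ENNReal.ofReal V := by
    intro J hJ
    rw [dvM_vol hD]
    rcases J.eq_empty_or_nonempty with rfl | hne
    · calc _ ≤ volume (Set.univ : Set ({j // j ∈ (∅ : Finset (Fin d))} → ℝ)) := measure_mono (Set.subset_univ _)
        _ = 1 := by simp [volume_pi]
        _ ≤ _ := by simpa using hV1
    · have hcard : 1 ≤ J.card ∧ J.card ≤ d - 1 := by
        refine ⟨hne.card_pos, ?_⟩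
        have : J.card < Fintype.card (Fin d) := Finset.card_lt_univ_of_notMem (x := (by
          exact (not_forall.1 (fun h => hJ (Finset.eq_univ_iff_forall.2 h))).choose))
          (not_forall.1 (fun h => hJ (Finset.eq_univ_iff_forall.2 h))).choose_spec
        rw [Fintype.card_fin] at this
        omega
      rw [← ENNReal.ofReal_toReal (hfinJ J).ne]
      apply ENNReal.ofReal_le_ofReal
      refine le_trans ?_ (le_max_left _ _)
      refine le_trans ?_ (le_ciSup (Set.finite_range _).bddAbove J)
      exact le_ciSup (f := fun _ : J ∈ {J : Finset (Fin d) | 1 ≤ J.card ∧ J.card ≤ d - 1} =>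
        (volume {z : {j // j ∈ J} → ℝ | ∃ x ∈ D, ∀ j : {j // j ∈ J}, z j = x ↑j}).toReal)
        (Set.finite_range _).bddAbove hcard
  have htele := dv_tele hD hT _ hW Finset.univ
  have hmu : dvMu (Finset.univ : Finset (Fin d)) = fun _ => dvNu := by
    funext j; simp [dvMu]
  rw [dvM_univ hD, dvM_univ hD, hmu, dv_pi_nu hD, ← volume_pi, Finset.card_univ, Fintype.card_fin] at htele
  have hvfin : volume D ≠ ⊤ := hD.measure_lt_top.ne
  have hE : (d : ℝ≥0∞) * (h * ((1 + h) ^ d * ENNReal.ofReal V)) = ENNReal.ofReal (d * (h * (1 + h) ^ d) * V) := by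
    have e1 : (1 + h : ℝ≥0∞) ^ d = ENNReal.ofReal ((1 + h) ^ d) := by
      rw [ENNReal.ofReal_pow (by positivity), ENNReal.ofReal_add (by norm_num) (by positivity)]; simp
    rw [e1, ENNReal.ofReal_mul (by positivity), ENNReal.ofReal_mul (by positivity), ENNReal.ofReal_mul (by positivity)]
    simp [mul_assoc]
  rw [hE] at htele
  set S := {y : Fin d → ℤ | (fun j => (y j : ℝ)) ∈ D} with hS
  have hSfin : S.Finite := by
    rw [← Set.encard_ne_top_iff]
    intro htop
    rw [htop] at htele
    have := htele.1
    simp [hvfin] at this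
  have hSn : ((S.encard : ℕ∞) : ℝ≥0∞) = ENNReal.ofReal (S.ncard : ℝ) := by
    rw [← hSfin.cast_ncard_eq]; simp
  rw [hSn, ← ENNReal.ofReal_toReal hvfin] at htele
  have hpos : (0 : ℝ) ≤ d * (h * (1 + h) ^ d) * V := by positivity
  rw [← ENNReal.ofReal_add ENNReal.toReal_nonneg hpos, ← ENNReal.ofReal_add (by positivity) hpos,
    ENNReal.ofReal_le_ofReal_iff (add_nonneg ENNReal.toReal_nonneg hpos),
    ENNReal.ofReal_le_ofReal_iff (by positivity)] at htele
  rw [abs_le]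
  constructor <;> nlinarith [htele.1, htele.2]
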